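/- For every k ∈ ℕ, the function X_{2k}(x) = ∫_{−∞}^x sign(t) h_{2k}(t) dt satisfies ∫_ℝ (X_{2k}(x))² dx = 2(−1 + √2 · Σ_{i=0}^k C(1/2, i)), and consequently ∫_ℝ (X_{2k}(x))² dx ≤ 3. -/

import Mathlib

open MeasureTheory Real

/-- The normalized Hermite function of degree `k`:
`h_k(t) = (−1)^k (2^k k! √π)^{−1/2} e^{t²/2} (d/dt)^k(e^{−t²})`. -/
noncomputable def hermiteFun (k : ℕ) (t : ℝ) : ℝ :=
  (-1 : ℝ) ^ k * ((2 : ℝ) ^ k * (Nat.factorial k : ℝ) * Real.sqrt π) ^ (-(1 : ℝ) / 2) *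
    Real.exp (t ^ 2 / 2) * iteratedDeriv k (fun s : ℝ => Real.exp (-s ^ 2)) t

/-- Generalized binomial coefficient `C(a,i) = a(a−1)⋯(a−i+1)/i!`. -/
noncomputable def genBinom (a : ℝ) (i : ℕ) : ℝ :=
  (∏ j ∈ Finset.range i, (a - j)) / (Nat.factorial i : ℝ)

/-- `X_{2k}(x) = ∫_{−∞}^x sign(t) h_{2k}(t) dt`. -/
noncomputable def Xeven (k : ℕ) (x : ℝ) : ℝ :=
  ∫ t in Set.Iic x, Real.sign t * hermiteFun (2 * k) t

open scoped Polynomial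

/-- The physicists' Hermite polynomials. -/
noncomputable def physHermite : ℕ → ℝ[X]
  | 0 => 1
  | n + 1 => 2 * Polynomial.X * physHermite n - Polynomial.derivative (physHermite n)

lemma derivative_physHermite_succ (n : ℕ) :
    Polynomial.derivative (physHermite (n + 1)) = (2 * ((n : ℝ[X]) + 1)) * physHermite n := by
  induction n with
  | zero => simp [physHermite]
  | succ n ih =>
    rw [physHermite, Polynomial.derivative_sub, ih]
    simp only [Polynomial.derivative_mul, Polynomial.derivative_ofNat, Polynomial.derivative_X,
      Polynomial.derivative_add, Polynomial.derivative_natCast, Polynomial.derivative_one, ih]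
    push_cast
    rw [physHermite]
    ring

lemma physHermite_add_two (n : ℕ) :
    physHermite (n + 2) =
      2 * Polynomial.X * physHermite (n + 1) - 2 * ((n : ℝ[X]) + 1) * physHermite n := by
  rw [physHermite, derivative_physHermite_succ]

lemma eval_neg_physHermite (n : ℕ) (x : ℝ) :
    (physHermite n).eval (-x) = (-1) ^ n * (physHermite n).eval x := by
  induction n using Nat.twoStepInduction with
  | zero => simp [physHermite]
  | one => simp [physHermite]
  | more n h₀ h₁ =>
    simp only [physHermite_add_two, Polynomial.eval_sub, Polynomial.eval_mul, Polynomial.eval_add,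
      Polynomial.eval_X, Polynomial.eval_ofNat, Polynomial.eval_natCast, Polynomial.eval_one,
      h₀, h₁]
    ring

/-- A polynomial times the Gaussian `e^{-x²/2}`. -/
noncomputable def polyGauss (p : ℝ[X]) (x : ℝ) : ℝ := p.eval x * Real.exp (-(1 / 2) * x ^ 2)

lemma hasDerivAt_polyGauss (p : ℝ[X]) (x : ℝ) :
    HasDerivAt (polyGauss p) (polyGauss (Polynomial.derivative p - Polynomial.X * p) x) x := by
  have h : HasDerivAt (fun x : ℝ => -(1 / 2) * x ^ 2) (-x) x := by
    refine ((hasDerivAt_pow 2 x).const_mul (-(1 / 2) : ℝ)).congr_deriv ?_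
    push_cast
    ring
  refine ((p.hasDerivAt x).mul h.exp).congr_deriv ?_
  simp only [polyGauss, Polynomial.eval_sub, Polynomial.eval_mul, Polynomial.eval_X]
  ring

lemma continuous_polyGauss (p : ℝ[X]) : Continuous (polyGauss p) :=
  continuous_iff_continuousAt.2 fun x => (hasDerivAt_polyGauss p x).continuousAt

lemma integrable_polyGauss (p : ℝ[X]) : Integrable (polyGauss p) := by
  induction p using Polynomial.induction_on' with
  | add p q hp hq =>
    refine (hp.add hq).congr (Filter.Eventually.of_forall fun x => ?_)
    simp [polyGauss, add_mul]
  | monomial n a =>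
    have h := (integrable_rpow_mul_exp_neg_mul_sq (b := 1 / 2) (by norm_num) (s := n)
      (by linarith [n.cast_nonneg (α := ℝ)])).const_mul a
    refine h.congr (Filter.Eventually.of_forall fun x => ?_)
    simp [polyGauss, mul_assoc]

/-- Continuous functions that are `O(e^{-x})` on the positive half-line. -/
def ExpDecay (f : ℝ → ℝ) : Prop :=
  Continuous f ∧ ∃ C, ∀ x, 0 ≤ x → |f x| ≤ C * Real.exp (-x)

namespace ExpDecay

variable {f g : ℝ → ℝ}

lemma add (hf : ExpDecay f) (hg : ExpDecay g) : ExpDecay (fun x => f x + g x) := by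
  obtain ⟨hf, C, hC⟩ := hf
  obtain ⟨hg, D, hD⟩ := hg
  refine ⟨hf.add hg, C + D, fun x hx => (abs_add_le _ _).trans ?_⟩
  linarith [hC x hx, hD x hx]

lemma const_mul (c : ℝ) (hf : ExpDecay f) : ExpDecay (fun x => c * f x) := by
  obtain ⟨hf, C, hC⟩ := hf
  refine ⟨hf.const_mul c, |c| * C, fun x hx => ?_⟩
  rw [abs_mul, mul_assoc]
  exact mul_le_mul_of_nonneg_left (hC x hx) (abs_nonneg c)

lemma id_mul_mul (hf : ExpDecay f) (hg : ExpDecay g) : ExpDecay (fun x => x * (f x * g x)) := by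
  obtain ⟨hf, C, hC⟩ := hf
  obtain ⟨hg, D, hD⟩ := hg
  refine ⟨continuous_id.mul (hf.mul hg), C * D, fun x hx => ?_⟩
  have h₁ : |f x| * |g x| ≤ (C * Real.exp (-x)) * (D * Real.exp (-x)) :=
    mul_le_mul (hC x hx) (hD x hx) (abs_nonneg _) ((abs_nonneg _).trans (hC x hx))
  have hCD : 0 ≤ C * D := by
    have hC' := (abs_nonneg _).trans (hC x hx)
    have hD' := (abs_nonneg _).trans (hD x hx)
    exact mul_nonneg (nonneg_of_mul_nonneg_left hC' (Real.exp_pos _))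
      (nonneg_of_mul_nonneg_left hD' (Real.exp_pos _))
  have h₂ : x * Real.exp (-x) ≤ 1 := by
    rw [Real.exp_neg, ← div_eq_mul_inv, div_le_one (Real.exp_pos x)]
    linarith [Real.add_one_le_exp x]
  rw [abs_mul, abs_mul, abs_of_nonneg hx]
  calc x * (|f x| * |g x|) ≤ x * ((C * Real.exp (-x)) * (D * Real.exp (-x))) := by gcongr
    _ = (C * D * Real.exp (-x)) * (x * Real.exp (-x)) := by ring
    _ ≤ (C * D * Real.exp (-x)) * 1 :=
        mul_le_mul_of_nonneg_left h₂ (mul_nonneg hCD (Real.exp_pos _).le)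
    _ = C * D * Real.exp (-x) := mul_one _

lemma mul (hf : ExpDecay f) (hg : ExpDecay g) : ExpDecay (fun x => f x * g x) := by
  obtain ⟨hf, C, hC⟩ := hf
  obtain ⟨hg, D, hD⟩ := hg
  refine ⟨hf.mul hg, C * D, fun x hx => ?_⟩
  have hC' := (abs_nonneg _).trans (hC x hx)
  have hD' : 0 ≤ D := nonneg_of_mul_nonneg_left ((abs_nonneg _).trans (hD x hx)) (Real.exp_pos _)
  have hD₁ : |g x| ≤ D := (hD x hx).trans
    (mul_le_of_le_one_right hD' (Real.exp_le_one_iff.2 (neg_nonpos.2 hx)))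
  rw [abs_mul]
  calc |f x| * |g x| ≤ (C * Real.exp (-x)) * D := mul_le_mul (hC x hx) hD₁ (abs_nonneg _) hC'
    _ = C * D * Real.exp (-x) := by ring

lemma integrableOn (hf : ExpDecay f) : IntegrableOn f (Set.Ioi 0) := by
  obtain ⟨hf, C, hC⟩ := hf
  refine Integrable.mono' ((integrableOn_exp_neg_Ioi 0).const_mul C)
    hf.aestronglyMeasurable ?_
  filter_upwards [ae_restrict_mem measurableSet_Ioi] with x hx using hC x (le_of_lt hx)

lemma tendsto (hf : ExpDecay f) : Filter.Tendsto f Filter.atTop (nhds 0) := by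
  obtain ⟨-, C, hC⟩ := hf
  refine squeeze_zero_norm' (a := fun x => C * Real.exp (-x)) ?_ ?_
  · filter_upwards [Filter.eventually_ge_atTop 0] with x hx using hC x hx
  · simpa using (Real.tendsto_exp_neg_atTop_nhds_zero).const_mul C

lemma integral_deriv (hf : ExpDecay f) (hg : ExpDecay g) (h : ∀ x, HasDerivAt f (g x) x) {a : ℝ}
    (ha : 0 ≤ a) : ∫ x in Set.Ioi a, g x = -f a := by
  rw [integral_Ioi_of_hasDerivAt_of_tendsto' (fun x _ => h x)
    (hg.integrableOn.mono_set (Set.Ioi_subset_Ioi ha)) hf.tendsto, zero_sub]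

end ExpDecay

lemma expDecay_polyGauss (p : ℝ[X]) : ExpDecay (polyGauss p) := by
  induction p using Polynomial.induction_on' with
  | add p q hp hq =>
    convert hp.add hq using 1
    ext x
    simp [polyGauss, add_mul]
  | monomial n a =>
    refine ⟨continuous_polyGauss _, |a| * (n.factorial * Real.exp 2), fun x hx => ?_⟩
    have h₁ : x ^ n ≤ n.factorial * Real.exp x := by
      have := Real.pow_div_factorial_le_exp x hx n
      rwa [div_le_iff₀' (by positivity)] at this
    have h₂ : Real.exp x * Real.exp (-(1 / 2) * x ^ 2) ≤ Real.exp 2 * Real.exp (-x) := by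
      rw [← Real.exp_add, ← Real.exp_add, Real.exp_le_exp]
      nlinarith [sq_nonneg (x - 2)]
    simp only [polyGauss, Polynomial.eval_monomial, abs_mul, Real.abs_exp, abs_pow,
      abs_of_nonneg hx]
    calc |a| * x ^ n * Real.exp (-(1 / 2) * x ^ 2)
        ≤ |a| * (n.factorial * Real.exp x) * Real.exp (-(1 / 2) * x ^ 2) := by gcongr
      _ = |a| * n.factorial * (Real.exp x * Real.exp (-(1 / 2) * x ^ 2)) := by ring
      _ ≤ |a| * n.factorial * (Real.exp 2 * Real.exp (-x)) := by gcongr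
      _ = _ := by ring

/-- The unnormalized Hermite functions `H_n(x) e^{-x²/2}`. -/
noncomputable def hermGauss (n : ℕ) : ℝ → ℝ := polyGauss (physHermite n)

lemma expDecay_hermGauss (n : ℕ) : ExpDecay (hermGauss n) := expDecay_polyGauss _

lemma hasDerivAt_hermGauss (n : ℕ) (x : ℝ) :
    HasDerivAt (hermGauss n) (x * hermGauss n x - hermGauss (n + 1) x) x := by
  refine (hasDerivAt_polyGauss (physHermite n) x).congr_deriv ?_
  simp only [hermGauss, polyGauss, physHermite, Polynomial.eval_sub, Polynomial.eval_mul,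
    Polynomial.eval_X, Polynomial.eval_ofNat]
  ring

lemma hermGauss_add_two (n : ℕ) (x : ℝ) :
    hermGauss (n + 2) x = 2 * x * hermGauss (n + 1) x - 2 * (n + 1) * hermGauss n x := by
  simp only [hermGauss, polyGauss, physHermite_add_two, Polynomial.eval_sub, Polynomial.eval_mul,
    Polynomial.eval_X, Polynomial.eval_ofNat, Polynomial.eval_add, Polynomial.eval_natCast,
    Polynomial.eval_one]
  ring

lemma hermGauss_zero (x : ℝ) : hermGauss 0 x = Real.exp (-(1 / 2) * x ^ 2) := by
  simp [hermGauss, polyGauss, physHermite]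

lemma hermGauss_neg (n : ℕ) (x : ℝ) : hermGauss n (-x) = (-1) ^ n * hermGauss n x := by
  simp only [hermGauss, polyGauss, eval_neg_physHermite, neg_sq, mul_assoc]

lemma hermGauss_odd_zero (k : ℕ) : hermGauss (2 * k + 1) 0 = 0 := by
  have h := hermGauss_neg (2 * k + 1) 0
  rw [neg_zero, Odd.neg_one_pow ⟨k, rfl⟩] at h
  linarith

lemma iteratedDeriv_exp_neg_sq (n : ℕ) :
    iteratedDeriv n (fun s : ℝ => Real.exp (-s ^ 2)) =
      fun x => (-1) ^ n * (physHermite n).eval x * Real.exp (-x ^ 2) := by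
  induction n with
  | zero => simp [physHermite]
  | succ n ih =>
    rw [iteratedDeriv_succ, ih]
    ext x
    have h : HasDerivAt (fun x : ℝ => -x ^ 2) (-(2 * x)) x := by
      refine (hasDerivAt_pow 2 x).neg.congr_deriv ?_
      simp
    refine ((((physHermite n).hasDerivAt x).const_mul ((-1) ^ n)).mul h.exp).deriv.trans ?_
    simp only [physHermite, Polynomial.eval_sub, Polynomial.eval_mul, Polynomial.eval_X,
      Polynomial.eval_ofNat]
    ring

/-- The normalizing constant of the Hermite function of degree `n`. -/
noncomputable def hermConst (n : ℕ) : ℝ :=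
  ((2 : ℝ) ^ n * (Nat.factorial n : ℝ) * Real.sqrt π) ^ (-(1 : ℝ) / 2)

lemma hermConst_sq (n : ℕ) :
    hermConst n ^ 2 = ((2 : ℝ) ^ n * (Nat.factorial n : ℝ) * Real.sqrt π)⁻¹ := by
  rw [hermConst, ← Real.rpow_natCast, ← Real.rpow_mul (by positivity), ← Real.rpow_neg_one]
  norm_num

lemma hermiteFun_eq (n : ℕ) (x : ℝ) : hermiteFun n x = hermConst n * hermGauss n x := by
  have h : Real.exp (x ^ 2 / 2) * Real.exp (-x ^ 2) = Real.exp (-(1 / 2) * x ^ 2) := by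
    rw [← Real.exp_add]
    congr 1
    ring
  have h₁ : ((-1 : ℝ) ^ n) * (-1) ^ n = 1 := by
    rw [← mul_pow]
    simp
  rw [hermiteFun, iteratedDeriv_exp_neg_sq, hermGauss, polyGauss, ← h, hermConst]
  linear_combination (_ ^ (-(1 : ℝ) / 2) * Real.exp (x ^ 2 / 2) *
    ((physHermite n).eval x * Real.exp (-x ^ 2))) * h₁

/-- The tail integral of the unnormalized Hermite function. -/
noncomputable def hermTail (n : ℕ) (x : ℝ) : ℝ := ∫ t in Set.Ioi x, hermGauss n t

lemma hasDerivAt_hermTail (n : ℕ) (x : ℝ) : HasDerivAt (hermTail n) (-hermGauss n x) x := by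
  have hi : Integrable (hermGauss n) := integrable_polyGauss _
  have hc : Continuous (hermGauss n) := continuous_polyGauss _
  have h : hermTail n = fun x => hermTail n 0 - ∫ t in (0 : ℝ)..x, hermGauss n t := by
    ext x
    rw [← intervalIntegral.integral_Ioi_sub_Ioi' hi.integrableOn hi.integrableOn]
    simp [hermTail]
  rw [h]
  exact (hc.integral_hasStrictDerivAt 0 x).hasDerivAt.const_sub _

lemma expDecay_hermTail (n : ℕ) : ExpDecay (hermTail n) := by
  refine ⟨continuous_iff_continuousAt.2 fun x => (hasDerivAt_hermTail n x).continuousAt, ?_⟩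
  obtain ⟨-, C, hC⟩ := expDecay_hermGauss n
  refine ⟨C, fun x hx => ?_⟩
  have h := norm_integral_le_of_norm_le (μ := volume.restrict (Set.Ioi x)) (f := hermGauss n)
    ((integrableOn_exp_neg_Ioi x).const_mul C) (by
      filter_upwards [ae_restrict_mem measurableSet_Ioi] with t ht
      exact hC t (hx.trans (le_of_lt ht)))
  rwa [integral_const_mul, integral_exp_neg_Ioi] at h

lemma hermTail_add_two (n : ℕ) {x : ℝ} (hx : 0 ≤ x) :
    hermTail (n + 2) x = 2 * (n + 1) * hermTail n x + 2 * hermGauss (n + 1) x := by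
  have hi (m : ℕ) : IntegrableOn (hermGauss m) (Set.Ioi x) := (integrable_polyGauss _).integrableOn
  have hd := ((expDecay_hermGauss (n + 2)).const_mul (-1)).add
    ((expDecay_hermGauss n).const_mul (2 * (n + 1)))
  have h := ((expDecay_hermGauss (n + 1)).const_mul 2).integral_deriv hd (fun t => by
    refine ((hasDerivAt_hermGauss (n + 1) t).const_mul 2).congr_deriv ?_
    linarith [hermGauss_add_two n t]) hx
  rw [integral_add ((hi _).const_mul _) ((hi _).const_mul _), integral_const_mul,
    integral_const_mul] at h
  simp only [hermTail]
  linarith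

lemma hermTail_zero_zero : hermTail 0 0 = √2 * √π / 2 := by
  simp only [hermTail, hermGauss_zero]
  rw [integral_gaussian_Ioi, ← Real.sqrt_mul (by norm_num)]
  congr 2
  ring

lemma integral_hermTail_zero_sq :
    ∫ x in Set.Ioi 0, hermTail 0 x ^ 2 = √2 * √π - √π := by
  have hT := expDecay_hermTail 0
  have hG := expDecay_hermGauss 0
  have hF := (hT.id_mul_mul hT).add ((hG.mul hT).const_mul (-2))
  have h := hF.integral_deriv (g := fun x => hermTail 0 x * hermTail 0 x +
      2 * (hermGauss 0 x * hermGauss 0 x))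
    ((hT.mul hT).add ((hG.mul hG).const_mul 2)) (fun x => by
      have hg : HasDerivAt (hermGauss 0) (-x * hermGauss 0 x) x := by
        refine (hasDerivAt_hermGauss 0 x).congr_deriv ?_
        simp only [hermGauss, polyGauss, physHermite, Polynomial.eval_sub,
          Polynomial.eval_mul, Polynomial.eval_X, Polynomial.eval_ofNat, Polynomial.eval_one,
          Polynomial.derivative_one, Polynomial.eval_zero]
        ring
      have ht := hasDerivAt_hermTail 0 x
      refine (((hasDerivAt_id x).mul (ht.mul ht)).add ((hg.mul ht).const_mul (-2))).congr_deriv ?_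
      simp
      ring) le_rfl
  have hsq : ∫ x in Set.Ioi 0, hermGauss 0 x * hermGauss 0 x = √π / 2 := by
    have : ∀ x, hermGauss 0 x * hermGauss 0 x = Real.exp (-1 * x ^ 2) := fun x => by
      rw [hermGauss_zero, ← Real.exp_add]
      congr 1
      ring
    simp only [this]
    rw [integral_gaussian_Ioi, div_one]
  rw [integral_add (hT.mul hT).integrableOn ((hG.mul hG).const_mul 2).integrableOn,
    integral_const_mul, hsq, hermTail_zero_zero, hermGauss_zero] at h
  simp only [sq]
  norm_num at h
  linarith

lemma integral_hermTail_sq_add_two (k : ℕ) :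
    ∫ x in Set.Ioi 0, hermTail (2 * k + 2) x ^ 2 =
      4 * (2 * k + 1) * (2 * k + 2) * (∫ x in Set.Ioi 0, hermTail (2 * k) x ^ 2) +
        8 * (2 * k + 1) * (hermGauss (2 * k) 0 * hermTail (2 * k) 0) := by
  set n := 2 * k with hn
  have hnk : (n : ℝ) = 2 * k := by simp [hn]
  have hT := expDecay_hermTail n
  have hG := expDecay_hermGauss n
  have hG₁ := expDecay_hermGauss (n + 1)
  have hF := (((hT.id_mul_mul hT).const_mul (-4 * (n + 1))).add
    ((hG.mul hT).const_mul (-8 * (n + 1)))).add ((hG₁.mul hG).const_mul (-4))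
  set F' : ℝ → ℝ := fun x => ((-4 * (n + 1)) * (hermTail n x * hermTail n x -
    2 * x * (hermGauss n x * hermTail n x)) + (-8 * (n + 1)) *
      ((x * hermGauss n x - hermGauss (n + 1) x) * hermTail n x - hermGauss n x * hermGauss n x)) +
    (-4) * (2 * (n + 1) * hermGauss n x * hermGauss n x
      - hermGauss (n + 1) x * hermGauss (n + 1) x) with hF'
  have hd : ∀ x, HasDerivAt _ (F' x) x := fun x => by
    have ht := hasDerivAt_hermTail n x
    have hg := hasDerivAt_hermGauss n x
    have hg₁ := hasDerivAt_hermGauss (n + 1) x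
    refine HasDerivAt.congr_deriv (((((hasDerivAt_id x).mul (ht.mul ht)).const_mul (-4 * ((n : ℝ) + 1))).add
      ((hg.mul ht).const_mul (-8 * ((n : ℝ) + 1)))).add ((hg₁.mul hg).const_mul (-4))) ?_
    rw [hermGauss_add_two]
    simp [hF']
    ring
  have hFd : ExpDecay F' := by
    convert (((hT.mul hT).const_mul (-4 * (n + 1))).add
      ((hG₁.mul hT).const_mul (8 * (n + 1)))).add ((hG₁.mul hG₁).const_mul 4) using 1
    ext x
    simp only [hF']
    ring
  have h := hF.integral_deriv hFd hd le_rfl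
  have hpt : ∀ x ∈ Set.Ioi (0 : ℝ), hermTail (n + 2) x ^ 2 =
      4 * (n + 1) * (n + 2) * (hermTail n x * hermTail n x) + F' x := fun x hx => by
    rw [hermTail_add_two n (le_of_lt hx)]
    simp only [hF']
    ring
  rw [setIntegral_congr_fun measurableSet_Ioi hpt,
    integral_add ((hT.mul hT).const_mul _).integrableOn hFd.integrableOn, h, integral_const_mul,
    hermGauss_odd_zero, hnk]
  simp only [sq]
  ring

lemma genBinom_succ (a : ℝ) (i : ℕ) :
    (i + 1) * genBinom a (i + 1) = (a - i) * genBinom a i := by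
  have : (i.factorial : ℝ) ≠ 0 := by positivity
  rw [genBinom, genBinom, Finset.prod_range_succ, Nat.factorial_succ]
  push_cast
  field_simp

lemma hermGauss_mul_hermTail_zero (k : ℕ) :
    hermGauss (2 * k) 0 * hermTail (2 * k) 0 =
      √2 * (k + 1) * genBinom (1 / 2) (k + 1) * (2 ^ (2 * k) * (2 * k).factorial * √π) := by
  induction k with
  | zero =>
    simp [hermTail_zero_zero, hermGauss_zero, genBinom]
    ring
  | succ k ih =>
    have hb := genBinom_succ (1 / 2) (k + 1)
    rw [show 2 * (k + 1) = 2 * k + 2 by ring, hermTail_add_two _ le_rfl, hermGauss_add_two,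
      hermGauss_odd_zero, Nat.factorial_succ, Nat.factorial_succ]
    push_cast at hb ⊢
    linear_combination (-4 * (2 * k + 1) ^ 2) * ih -
      √2 * (2 ^ (2 * k + 2) * ((2 * k + 2) * ((2 * k + 1) * (2 * k).factorial)) * √π) * hb

lemma integral_hermTail_sq (k : ℕ) :
    ∫ x in Set.Ioi 0, hermTail (2 * k) x ^ 2 =
      (-1 + √2 * ∑ i ∈ Finset.range (k + 1), genBinom (1 / 2) i) *
        (2 ^ (2 * k) * (2 * k).factorial * √π) := by
  induction k with
  | zero =>
    rw [mul_zero, integral_hermTail_zero_sq]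
    simp [genBinom]
    ring
  | succ k ih =>
    rw [show 2 * (k + 1) = 2 * k + 2 by ring, integral_hermTail_sq_add_two, ih,
      hermGauss_mul_hermTail_zero, Nat.factorial_succ, Nat.factorial_succ,
      Finset.sum_range_succ _ (k + 1)]
    push_cast
    ring

lemma sum_genBinom_half_le (k : ℕ) :
    ∑ i ∈ Finset.range (k + 1), genBinom (1 / 2) i ≤ 3 / 2 := by
  suffices h : ∀ k : ℕ, ∑ i ∈ Finset.range (k + 1), genBinom (1 / 2) i ≤ 3 / 2 ∧
      ∑ i ∈ Finset.range (k + 2), genBinom (1 / 2) i ≤ 3 / 2 from (h k).1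
  intro k
  induction k with
  | zero => norm_num [Finset.sum_range_succ, genBinom]
  | succ k ih =>
    refine ⟨ih.2, ?_⟩
    obtain ⟨h₀, h₁⟩ := ih
    have hb := genBinom_succ (1 / 2) (k + 1)
    rw [Finset.sum_range_succ _ (k + 2)]
    rw [Finset.sum_range_succ _ (k + 1)] at h₁ ⊢
    push_cast at hb
    have hk : (0 : ℝ) ≤ k := k.cast_nonneg
    refine le_of_mul_le_mul_left ?_ (by linarith : (0 : ℝ) < k + 2)
    nlinarith [mul_le_mul_of_nonneg_left h₀ (by linarith : 0 ≤ (k : ℝ) + 1 / 2)]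

lemma Xeven_eq (k : ℕ) (x : ℝ) : Xeven k x = -hermConst (2 * k) * hermTail (2 * k) |x| := by
  have hi : Integrable (hermGauss (2 * k)) := integrable_polyGauss _
  have hneg (t : ℝ) : hermGauss (2 * k) (-t) = hermGauss (2 * k) t := by
    simp [hermGauss_neg]
  have hX_nonpos {y : ℝ} (hy : y ≤ 0) :
      Xeven k y = -hermConst (2 * k) * hermTail (2 * k) (-y) := by
    rw [hermTail, ← integral_comp_neg_Iic, Xeven, ← integral_const_mul,
      integral_Iic_eq_integral_Iio, integral_Iic_eq_integral_Iio]
    refine setIntegral_congr_fun measurableSet_Iio fun t ht => ?_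
    simp only [Real.sign_of_neg (lt_of_lt_of_le ht hy), hneg, hermiteFun_eq]
    ring
  rcases le_total x 0 with hx | hx
  · rw [hX_nonpos hx, abs_of_nonpos hx]
  · have hpos : ∫ t in Set.Ioc 0 x, Real.sign t * hermiteFun (2 * k) t =
        hermConst (2 * k) * ∫ t in Set.Ioc 0 x, hermGauss (2 * k) t := by
      rw [← integral_const_mul]
      refine setIntegral_congr_fun measurableSet_Ioc fun t ht => ?_
      simp only [Real.sign_of_pos ht.1, hermiteFun_eq, one_mul]
    have hsi : Integrable (fun t => Real.sign t * hermiteFun (2 * k) t) := by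
      refine (hi.const_mul (hermConst (2 * k))).norm.mono' ?_ ?_
      · simp only [hermiteFun_eq]
        refine AEStronglyMeasurable.mul ?_ (hi.const_mul _).aestronglyMeasurable
        refine (Measurable.ite measurableSet_Iio measurable_const
          (Measurable.ite measurableSet_Ioi measurable_const measurable_const)).aestronglyMeasurable
      · refine Filter.Eventually.of_forall fun t => ?_
        rw [norm_mul, hermiteFun_eq]
        refine mul_le_of_le_one_left (norm_nonneg _) ?_
        rcases Real.sign_apply_eq t with h | h | h <;> simp [h]
    have hsplit : Xeven k x =
        Xeven k 0 + ∫ t in Set.Ioc 0 x, Real.sign t * hermiteFun (2 * k) t := by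
      rw [Xeven, ← Set.Iic_union_Ioc_eq_Iic hx, setIntegral_union (Set.Iic_disjoint_Ioc le_rfl)
        measurableSet_Ioc hsi.integrableOn hsi.integrableOn, Xeven]
    have htail : hermTail (2 * k) 0 =
        (∫ t in Set.Ioc 0 x, hermGauss (2 * k) t) + hermTail (2 * k) x := by
      rw [hermTail, ← Set.Ioc_union_Ioi_eq_Ioi hx, setIntegral_union
        (Set.Ioc_disjoint_Ioi le_rfl) measurableSet_Ioi hi.integrableOn hi.integrableOn, hermTail]
    rw [hsplit, hX_nonpos le_rfl, hpos, neg_zero, htail, abs_of_nonneg hx]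
    ring

theorem even_antiderivative_L2_norm (k : ℕ) :
    (∫ x : ℝ, (Xeven k x) ^ 2)
        = 2 * (-1 + Real.sqrt 2 * ∑ i ∈ Finset.range (k + 1), genBinom (1 / 2) i) ∧
      (∫ x : ℝ, (Xeven k x) ^ 2) ≤ 3 := by
  have h : (∫ x : ℝ, (Xeven k x) ^ 2)
      = 2 * (-1 + Real.sqrt 2 * ∑ i ∈ Finset.range (k + 1), genBinom (1 / 2) i) := by
    simp only [Xeven_eq, mul_pow, neg_sq]
    rw [integral_const_mul, integral_comp_abs (f := fun x => hermTail (2 * k) x ^ 2),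
      integral_hermTail_sq, hermConst_sq]
    field_simp
  refine ⟨h, h.trans_le ?_⟩
  have h₁ := sum_genBinom_half_le k
  have h₂ : √2 ≤ 5 / 3 := Real.sqrt_le_iff.2 (by norm_num)
  nlinarith [mul_le_mul_of_nonneg_left h₁ (Real.sqrt_nonneg 2)]
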